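/- arXiv:1002.1602 — 2 statements merged into one kernel-verified Lean document; each statement's English description precedes it below -/
import Mathlib

section
/- Let V be a Banach space and F : [0,∞) → L(V) a map into the bounded linear operators on V with F(0) = 1. Suppose there exist constants M > 0 and a ∈ ℝ such that ‖F(t)‖ ≤ M e^{at} for all t ≥ 0, and ‖F(t)^n‖ ≤ M whenever n ∈ ℕ and nt ≤ 1. Then there exists ω ∈ ℝ (one may take ω = 2·max(a, log M)) such that ‖F(t)^n‖ ≤ M e^{ω n t} for all t ≥ 0 and all n ∈ ℕ. -/
/-- If `F : [0,∞) → L(V)` satisfies `F 0 = 1`, `‖F t‖ ≤ M e^{a t}` for `t ≥ 0`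
and `‖(F t)^n‖ ≤ M` whenever `n * t ≤ 1`, then there is `ω ∈ ℝ` with
`‖(F t)^n‖ ≤ M e^{ω n t}` for all `t ≥ 0`, `n ∈ ℕ`. -/
theorem stmt0
    {V : Type*} [NormedAddCommGroup V] [NormedSpace ℝ V] [CompleteSpace V]
    (F : ℝ → V →L[ℝ] V) (hF0 : F 0 = 1)
    (M a : ℝ) (hM : 0 < M)
    (hexp : ∀ t : ℝ, 0 ≤ t → ‖F t‖ ≤ M * Real.exp (a * t))
    (hpow : ∀ (n : ℕ) (t : ℝ), 0 ≤ t → (n : ℝ) * t ≤ 1 → ‖(F t) ^ n‖ ≤ M) :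
    ∃ ω : ℝ, ∀ (t : ℝ), 0 ≤ t → ∀ n : ℕ, ‖(F t) ^ n‖ ≤ M * Real.exp (ω * n * t) := by
  rcases subsingleton_or_nontrivial V with hV | hV
  · refine ⟨0, fun t _ n => ?_⟩
    have h : (F t) ^ n = 0 := Subsingleton.elim _ _
    rw [h, norm_zero]
    positivity
  have hM1 : 1 ≤ M := by
    have h := hpow 0 0 le_rfl (by simp)
    rwa [pow_zero, norm_one] at h
  have hL : 0 ≤ Real.log M := Real.log_nonneg hM1
  have hME : ∀ m : ℕ, M ^ m = Real.exp (m * Real.log M) := by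
    intro m
    rw [Real.exp_nat_mul, Real.exp_log hM]
  have ha : a ≤ |a| := le_abs_self a
  have ha0 : 0 ≤ |a| := abs_nonneg a
  refine ⟨|a| + 2 * Real.log M, fun t ht n => ?_⟩
  have hn0 : (0 : ℝ) ≤ n := Nat.cast_nonneg n
  have hnt : 0 ≤ (n : ℝ) * t := mul_nonneg hn0 ht
  rcases le_or_gt t 1 with h1 | h1
  · rcases ht.eq_or_lt with h0 | h0
    · subst h0
      have h := hpow n 0 le_rfl (by simp)
      simpa using h
    set k : ℕ := ⌊1 / t⌋₊ with hk
    have hk1 : 1 ≤ k := by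
      rw [hk, Nat.one_le_floor_iff, le_div_iff₀ h0]
      linarith
    have hkt : (k : ℝ) * t ≤ 1 := by
      have h : (k : ℝ) ≤ 1 / t := Nat.floor_le (by positivity)
      rwa [le_div_iff₀ h0] at h
    have hkt2 : 1 ≤ 2 * ((k : ℝ) * t) := by
      have h : 1 / t < (k : ℝ) + 1 := Nat.lt_floor_add_one _
      rw [div_lt_iff₀ h0] at h
      have h' : (1 : ℝ) ≤ k := by exact_mod_cast hk1
      nlinarith
    have hdm := Nat.div_add_mod n k
    set q := n / k
    have hr : n % k < k := Nat.mod_lt _ hk1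
    set r := n % k
    have hrt : (r : ℝ) * t ≤ 1 := by
      have h : (r : ℝ) ≤ k := by exact_mod_cast hr.le
      nlinarith
    have hq : (q : ℝ) ≤ 2 * (n * t) := by
      have h : (n : ℝ) = k * q + r := by exact_mod_cast hdm.symm
      have hq0 : (0 : ℝ) ≤ q := Nat.cast_nonneg q
      have hr0 : (0 : ℝ) ≤ r * t := mul_nonneg (Nat.cast_nonneg r) ht
      rw [h]
      nlinarith [mul_le_mul_of_nonneg_left hkt2 hq0]
    calc ‖(F t) ^ n‖ = ‖((F t) ^ k) ^ q * (F t) ^ r‖ := by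
          rw [← pow_mul, ← pow_add, hdm]
      _ ≤ ‖((F t) ^ k) ^ q‖ * ‖(F t) ^ r‖ := norm_mul_le _ _
      _ ≤ M ^ q * M := by
          gcongr
          · exact (norm_pow_le _ _).trans (pow_le_pow_left₀ (norm_nonneg _) (hpow k t ht hkt) q)
          · exact hpow r t ht hrt
      _ = M * Real.exp (q * Real.log M) := by rw [hME, mul_comm]
      _ ≤ M * Real.exp ((|a| + 2 * Real.log M) * n * t) := by
          refine mul_le_mul_of_nonneg_left (Real.exp_le_exp.mpr ?_) hM.le
          nlinarith [mul_le_mul_of_nonneg_right hq hL, mul_nonneg ha0 hnt]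
  · have hnn : (n : ℝ) ≤ n * t := by nlinarith
    calc ‖(F t) ^ n‖ ≤ ‖F t‖ ^ n := norm_pow_le _ _
      _ ≤ (M * Real.exp (a * t)) ^ n := pow_le_pow_left₀ (norm_nonneg _) (hexp t ht) n
      _ = Real.exp (n * Real.log M + n * (a * t)) := by
          rw [mul_pow, hME, ← Real.exp_nat_mul, ← Real.exp_add]
      _ ≤ Real.exp ((|a| + 2 * Real.log M) * n * t) := by
          refine Real.exp_le_exp.mpr ?_
          nlinarith [mul_le_mul_of_nonneg_right hnn hL, mul_le_mul_of_nonneg_right ha hnt,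
            mul_nonneg hL hnt]
      _ ≤ M * Real.exp ((|a| + 2 * Real.log M) * n * t) :=
          le_mul_of_one_le_left (Real.exp_pos _).le hM1
end

section
/- Let X₁, …, Xₙ, Y and Z be Banach spaces and η : Y → Z a continuous injective linear map. Suppose A : X₁ × ⋯ × Xₙ → Z is a continuous n-linear map whose range is contained in the range of η, and let Ã : X₁ × ⋯ × Xₙ → Y be the (unique) n-linear map with η ∘ Ã = A. Then Ã is continuous. -/
/-- Let `X₁, …, Xₙ, Y, Z` be Banach spaces, `η : Y → Z` a continuous injective
linear map, and `A : X₁ × ⋯ × Xₙ → Z` a continuous `n`-linear map whose lift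
`Ã : X₁ × ⋯ × Xₙ → Y` along `η` (i.e. `η ∘ Ã = A`) exists. Then `Ã` is continuous. -/
theorem stmt5
    {ι : Type*} [Fintype ι]
    {X : ι → Type*} [∀ i, NormedAddCommGroup (X i)] [∀ i, NormedSpace ℝ (X i)]
    [∀ i, CompleteSpace (X i)]
    {Y : Type*} [NormedAddCommGroup Y] [NormedSpace ℝ Y] [CompleteSpace Y]
    {Z : Type*} [NormedAddCommGroup Z] [NormedSpace ℝ Z] [CompleteSpace Z]
    (η : Y →L[ℝ] Z) (hη : Function.Injective η)
    (A : ContinuousMultilinearMap ℝ X Z)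
    (B : MultilinearMap ℝ X Y) (hB : ∀ x : ∀ i, X i, η (B x) = A x) :
    Continuous fun x : ∀ i, X i => B x := by
  classical
  have hcont : ∀ (y : ∀ i, X i) (a : ι), Continuous (B.toLinearMap y a) := by
    intro y a
    refine (B.toLinearMap y a).continuous_of_seq_closed_graph fun u v w hu hw => ?_
    apply hη
    have h1 : Filter.Tendsto (fun n => η (B.toLinearMap y a (u n))) Filter.atTop (nhds (η w)) :=
      (η.continuous.tendsto w).comp hw
    have hc : Continuous fun v : X a => A (Function.update y a v) :=
      A.cont.comp (continuous_const.update a continuous_id)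
    have h2 : Filter.Tendsto (fun n => A (Function.update y a (u n))) Filter.atTop
        (nhds (A (Function.update y a v))) := (hc.tendsto v).comp hu
    simp only [MultilinearMap.toLinearMap_apply, hB] at h1 ⊢
    exact tendsto_nhds_unique h1 h2
  have key : ∀ (S : Finset ι) (x : ∀ i, X i), ∃ C : ℝ, ∀ y : ∀ i, X i,
      (∀ i ∈ S, ‖y i‖ ≤ 1) → (∀ i, i ∉ S → y i = x i) → ‖B y‖ ≤ C := by
    intro S
    induction S using Finset.induction_on with
    | empty =>
      intro x
      refine ⟨‖B x‖, fun y _ h => ?_⟩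
      have : y = x := funext fun i => h i (by simp)
      rw [this]
    | insert a S ha ih =>
      intro x
      let I := {y : ∀ i, X i // (∀ i ∈ S, ‖y i‖ ≤ 1) ∧ ∀ i, i ∉ S → y i = x i}
      let g : I → X a →L[ℝ] Y := fun y => ⟨B.toLinearMap y.1 a, hcont y.1 a⟩
      have hg : ∀ y v, g y v = B (Function.update y.1 a v) := fun y v => rfl
      obtain ⟨C, hC⟩ := banach_steinhaus (g := g) (by
        intro v
        obtain ⟨C, hC⟩ := ih (Function.update x a v)
        refine ⟨C, fun y => ?_⟩
        rw [hg]
        apply hC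
        · intro i hi
          have : i ≠ a := fun h => ha (h ▸ hi)
          rw [Function.update_of_ne this]
          exact y.2.1 i hi
        · intro i hi
          by_cases h : i = a
          · subst h; simp
          · rw [Function.update_of_ne h, Function.update_of_ne h]
            exact y.2.2 i hi)
      refine ⟨C, fun z hz hz' => ?_⟩
      let y : I := ⟨Function.update z a (x a), by
        constructor
        · intro i hi
          have : i ≠ a := fun h => ha (h ▸ hi)
          rw [Function.update_of_ne this]
          exact hz i (Finset.mem_insert_of_mem hi)
        · intro i hi
          by_cases h : i = a
          · subst h; simp
          · rw [Function.update_of_ne h]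
            exact hz' i (by simp [h, hi])⟩
      have h1 : g y (z a) = B z := by
        rw [hg]; simp [y]
      rw [← h1]
      calc ‖g y (z a)‖ ≤ ‖g y‖ * ‖z a‖ := (g y).le_opNorm _
        _ ≤ ‖g y‖ * 1 := by
          gcongr
          exact hz a (Finset.mem_insert_self a S)
        _ ≤ C := by rw [mul_one]; exact hC y
  obtain ⟨C, hC⟩ := key Finset.univ 0
  refine B.continuous_of_bound C fun x => ?_
  by_cases h : ∃ i, x i = 0
  · obtain ⟨i, hi⟩ := h
    rw [B.map_coord_zero i hi, norm_zero, Finset.prod_eq_zero (Finset.mem_univ i) (by simp [hi]),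
      mul_zero]
  · push Not at h
    have hx : x = fun i => ‖x i‖ • (‖x i‖⁻¹ • x i) := by
      funext i
      rw [smul_inv_smul₀ (norm_ne_zero_iff.2 (h i))]
    have h2 : ‖B fun i => ‖x i‖⁻¹ • x i‖ ≤ C := by
      apply hC
      · intro i _
        rw [norm_smul, norm_inv, norm_norm, inv_mul_cancel₀ (norm_ne_zero_iff.2 (h i))]
      · intro i hi
        exact absurd (Finset.mem_univ i) hi
    have h3 : B x = (∏ i, ‖x i‖) • B fun i => ‖x i‖⁻¹ • x i := by
      conv_lhs => rw [hx]
      exact B.map_smul_univ _ _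
    rw [h3, norm_smul, Real.norm_of_nonneg (by positivity), mul_comm]
    gcongr
end
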